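/- Let n ≥ 4 and let M = M_n[k,ℓ] be a rank-2 lattice path matroid on [n] with 1 ≤ k ≤ ℓ ≤ n−2. Then for every m ≥ 0, the h*-vector of P_M satisfies h*_m(P_{M_n[k,ℓ]}) = h*_m(P_{M_n[1,ℓ]}) + h*_m(P_{M_n[1,n−k−1]}) − h*_m(P_{U_{2,n}}); that is, the h*-vector of any rank-2 LPM is determined by h*-vectors of rank-2 Schubert matroids and of the hypersimplex Δ_{2,n}. -/

import Mathlib

/-!
Statement 19: The `h*`-vector of any rank-2 lattice path matroid `M_n[k,ℓ]` is
determined by `h*`-vectors of rank-2 Schubert matroids and of the hypersimplex: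
`h*_m(M_n[k,ℓ]) = h*_m(M_n[1,ℓ]) + h*_m(M_n[1,n-k-1]) - h*_m(U_{2,n})`.
-/

open scoped Classical Pointwise

/-- The height of the lattice path associated to `A ⊆ [n]` after `i` steps:
the number of north steps (elements of `A`) among the first `i` steps. -/
def pathHeight {n : ℕ} (A : Finset (Fin n)) (i : ℕ) : ℕ :=
  (A.filter fun j => j.val < i).card

/-- The 0/1 indicator vector of a subset of `[n]`. -/
def indVec {n : ℕ} (B : Finset (Fin n)) : Fin n → ℝ :=
  fun i => if i ∈ B then 1 else 0

/-- Height after `i` steps of the upper path `U` of `M_n[k,ℓ]`, which has north steps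
at positions `1` and `n - ℓ`. -/
def upperHt (n l i : ℕ) : ℕ :=
  (if 1 ≤ i then 1 else 0) + (if n - l ≤ i then 1 else 0)

/-- Height after `i` steps of the lower path `L` of `M_n[k,ℓ]`, which has its two
north steps at the end of the diagram (positions `n - k` and `n`). -/
def lowerHt (n k i : ℕ) : ℕ :=
  (if n - k ≤ i then 1 else 0) + (if n ≤ i then 1 else 0)

/-- The bases of the rank-2 lattice path matroid `M_n[k,ℓ]`: all `2`-subsets of `[n]`
whose lattice path lies weakly between the lower and upper paths. -/
noncomputable def MklBases (n k l : ℕ) : Finset (Finset (Fin n)) :=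
  Finset.univ.filter fun B => B.card = 2 ∧
    ∀ i ∈ Finset.range (n + 1),
      lowerHt n k i ≤ pathHeight B i ∧ pathHeight B i ≤ upperHt n l i

/-- The matroid polytope of `M_n[k,ℓ]`. -/
noncomputable def MklPolytope (n k l : ℕ) : Set (Fin n → ℝ) :=
  convexHull ℝ {x | ∃ B ∈ MklBases n k l, x = indVec B}

/-- The number of lattice (integer) points of a subset of `ℝⁿ`. -/
noncomputable def latticeCount {n : ℕ} (S : Set (Fin n → ℝ)) : ℕ :=
  Set.ncard {x ∈ S | ∀ i, ∃ m : ℤ, x i = (m : ℝ)}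

/-- The normalized volume of a `d`-dimensional lattice polytope `P`: the `d`-th finite
difference at `0` of the Ehrhart counting function, i.e. `d! · vol(P)`. -/
noncomputable def normVol {n : ℕ} (P : Set (Fin n → ℝ)) (d : ℕ) : ℤ :=
  ∑ j ∈ Finset.range (d + 1),
    (-1 : ℤ) ^ j * (d.choose j : ℤ) * (latticeCount (((d - j : ℕ) : ℝ) • P) : ℤ)

/-- `σ_n(k,ℓ)`: the normalized volume of the rank-2 lattice path matroid polytope
`P_{M_n[k,ℓ]}`, set to `0` when the parameters are out of range. -/
noncomputable def sigmaVol (n k l : ℕ) : ℤ :=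
  if 1 ≤ k ∧ k ≤ l ∧ l ≤ n - 2 then normVol (MklPolytope n k l) (n - 1) else 0

/-- `h` is the `h*`-vector of the lattice polytope `P` of dimension `d`:
`L_P(t) = ∑_{k=0}^{d} h_k · C(t + d - k, d)` for all `t ≥ 0`, and `h` vanishes beyond
degree `d`. -/
def IsHStarVector {n : ℕ} (P : Set (Fin n → ℝ)) (d : ℕ) (h : ℕ → ℕ) : Prop :=
  (∀ t : ℕ, latticeCount ((t : ℝ) • P) =
      ∑ k ∈ Finset.range (d + 1), h k * Nat.choose (t + d - k) d) ∧
  ∀ k, d < k → h k = 0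

/-- The sum of the first `m` coordinates of a vector. -/
def prefixSum {M : Type*} [AddCommMonoid M] {n : ℕ} (x : Fin n → M) (m : ℕ) : M :=
  ∑ i with i.val < m, x i

lemma prefixSum_zero {M : Type*} [AddCommMonoid M] {n : ℕ} (x : Fin n → M) :
    prefixSum x 0 = 0 := by
  simp [prefixSum]

lemma prefixSum_succ {M : Type*} [AddCommMonoid M] {n : ℕ} (x : Fin n → M) {m : ℕ}
    (h : m < n) : prefixSum x (m + 1) = prefixSum x m + x ⟨m, h⟩ := by
  have hs : (Finset.univ.filter fun i : Fin n => i.val < m + 1) =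
      insert ⟨m, h⟩ (Finset.univ.filter fun i : Fin n => i.val < m) := by
    ext i
    simp only [Finset.mem_filter, Finset.mem_univ, true_and, Finset.mem_insert, Fin.ext_iff]
    omega
  unfold prefixSum
  rw [hs, Finset.sum_insert (by simp), add_comm]

lemma prefixSum_of_le {M : Type*} [AddCommMonoid M] {n : ℕ} (x : Fin n → M) {m : ℕ}
    (h : n ≤ m) : prefixSum x m = ∑ i, x i := by
  unfold prefixSum
  rw [Finset.filter_true_of_mem fun i _ => i.isLt.trans_le h]

lemma prefixSum_mono {n : ℕ} (x : Fin n → ℕ) : Monotone (prefixSum x) := by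
  intro a b hab
  refine Finset.sum_le_sum_of_subset fun i => ?_
  simp only [Finset.mem_filter, Finset.mem_univ, true_and]
  omega

lemma prefixSum_comp_rev {n : ℕ} (x : Fin n → ℕ) (m : ℕ) :
    prefixSum (x ∘ Fin.rev) m + prefixSum x (n - m) = ∑ i, x i := by
  have h : prefixSum (x ∘ Fin.rev) m = ∑ i with ¬ i.val < n - m, x i := by
    unfold prefixSum
    refine Finset.sum_nbij' Fin.rev Fin.rev ?_ ?_ ?_ ?_ ?_
    · intro i; simp [Fin.val_rev]; omega
    · intro i; simp [Fin.val_rev]; omega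
    all_goals simp
  rw [h, add_comm]
  exact Finset.sum_filter_add_sum_filter_not _ _ _

lemma prefixSum_natCast {n : ℕ} (x : Fin n → ℕ) (m : ℕ) :
    prefixSum (fun i => (x i : ℝ)) m = ((prefixSum x m : ℕ) : ℝ) := by
  simp [prefixSum]

lemma prefixSum_combo {n : ℕ} (a b : ℝ) (x y : Fin n → ℝ) (m : ℕ) :
    prefixSum (a • x + b • y) m = a * prefixSum x m + b * prefixSum y m := by
  simp [prefixSum, Finset.sum_add_distrib, Finset.mul_sum]

lemma prefixSum_indVec {n : ℕ} (B : Finset (Fin n)) (m : ℕ) :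
    prefixSum (indVec B) m = (pathHeight B m : ℝ) := by
  simp only [prefixSum, indVec, pathHeight, Finset.sum_boole]
  congr 2
  ext i
  simp [and_comm]

lemma pathHeight_of_le {n : ℕ} (B : Finset (Fin n)) {m : ℕ} (h : n ≤ m) :
    pathHeight B m = B.card := by
  unfold pathHeight
  rw [Finset.filter_true_of_mem fun i _ => i.isLt.trans_le h]

lemma pathHeight_zero {n : ℕ} (B : Finset (Fin n)) : pathHeight B 0 = 0 := by
  simp [pathHeight]

lemma pathHeight_succ {n : ℕ} (B : Finset (Fin n)) {m : ℕ} (h : m < n) :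
    pathHeight B (m + 1) = pathHeight B m + if ⟨m, h⟩ ∈ B then 1 else 0 := by
  have := prefixSum_succ (indVec B) h
  rw [prefixSum_indVec, prefixSum_indVec] at this
  simp only [indVec] at this
  split_ifs at this ⊢ <;> exact_mod_cast this

/-- The points satisfying the inequalities that cut out the `t`-th dilate of the polytope of
`M_n[k,ℓ]`. -/
def lpmRegion (R : Type*) [Semiring R] [PartialOrder R] (n k l : ℕ) (t : R) :
    Set (Fin n → R) :=
  {x | (∀ i, 0 ≤ x i ∧ x i ≤ t) ∧ ∑ i, x i = 2 * t ∧
    t ≤ prefixSum x (n - k) ∧ prefixSum x (n - l - 1) ≤ t}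

lemma natCast_mem_lpmRegion {n k l t : ℕ} {x : Fin n → ℕ} :
    (fun i => (x i : ℝ)) ∈ lpmRegion ℝ n k l (t : ℝ) ↔ x ∈ lpmRegion ℕ n k l t := by
  simp only [lpmRegion, Set.mem_ofPred_eq, prefixSum_natCast]
  norm_cast

lemma convex_lpmRegion (n k l : ℕ) (t : ℝ) : Convex ℝ (lpmRegion ℝ n k l t) := by
  rintro x ⟨hx₁, hx₂, hx₃, hx₄⟩ y ⟨hy₁, hy₂, hy₃, hy₄⟩ a b ha hb hab
  have ht : t = a * t + b * t := by rw [← add_mul, hab, one_mul]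
  refine ⟨fun i => ?_, ?_, ?_, ?_⟩
  · simp only [Pi.add_apply, Pi.smul_apply, smul_eq_mul]
    have h₁ := mul_nonneg ha (hx₁ i).1
    have h₂ := mul_nonneg hb (hy₁ i).1
    have h₃ := mul_le_mul_of_nonneg_left (hx₁ i).2 ha
    have h₄ := mul_le_mul_of_nonneg_left (hy₁ i).2 hb
    constructor <;> linarith
  · simp only [Pi.add_apply, Pi.smul_apply, smul_eq_mul, Finset.sum_add_distrib,
      ← Finset.mul_sum, hx₂, hy₂]
    linarith
  · rw [prefixSum_combo]
    have h₃ := mul_le_mul_of_nonneg_left hx₃ ha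
    have h₄ := mul_le_mul_of_nonneg_left hy₃ hb
    linarith
  · rw [prefixSum_combo]
    have h₃ := mul_le_mul_of_nonneg_left hx₄ ha
    have h₄ := mul_le_mul_of_nonneg_left hy₄ hb
    linarith

lemma smul_mem_lpmRegion {n k l : ℕ} {t : ℝ} (ht : 0 ≤ t) {x : Fin n → ℝ}
    (hx : x ∈ lpmRegion ℝ n k l 1) : t • x ∈ lpmRegion ℝ n k l t := by
  obtain ⟨h₁, h₂, h₃, h₄⟩ := hx
  have hp (m : ℕ) : prefixSum (t • x) m = t * prefixSum x m := by
    simp [prefixSum, Finset.mul_sum]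
  refine ⟨fun i => ⟨mul_nonneg ht (h₁ i).1, ?_⟩, ?_, ?_, ?_⟩
  · simpa using mul_le_mul_of_nonneg_left (h₁ i).2 ht
  · simp only [Pi.smul_apply, smul_eq_mul, ← Finset.mul_sum, h₂]
    ring
  · rw [hp]
    simpa using mul_le_mul_of_nonneg_left h₃ ht
  · rw [hp]
    simpa using mul_le_mul_of_nonneg_left h₄ ht

lemma indVec_mem_lpmRegion {n k l : ℕ} (hl : l < n) {B : Finset (Fin n)}
    (hB : B ∈ MklBases n k l) : indVec B ∈ lpmRegion ℝ n k l 1 := by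
  simp only [MklBases, Finset.mem_filter, Finset.mem_univ, true_and, Finset.mem_range] at hB
  obtain ⟨hc, hB⟩ := hB
  refine ⟨fun i => ?_, ?_, ?_, ?_⟩
  · unfold indVec
    split_ifs <;> norm_num
  · rw [← prefixSum_of_le _ le_rfl, prefixSum_indVec, pathHeight_of_le _ le_rfl, hc]
    norm_num
  · rw [prefixSum_indVec]
    have := (hB (n - k) (by omega)).1
    simp only [lowerHt, le_refl, if_true] at this
    exact_mod_cast (Nat.le_add_right _ _).trans this
  · rw [prefixSum_indVec]
    have := (hB (n - l - 1) (by omega)).2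
    have h : upperHt n l (n - l - 1) ≤ 1 := by
      unfold upperHt
      split_ifs <;> omega
    exact_mod_cast this.trans h

lemma MklPolytope_subset_lpmRegion {n k l : ℕ} (hl : l < n) :
    MklPolytope n k l ⊆ lpmRegion ℝ n k l 1 := by
  refine convexHull_min ?_ (convex_lpmRegion n k l 1)
  rintro x ⟨B, hB, rfl⟩
  exact indVec_mem_lpmRegion hl hB

/-- List the coordinate indices of `x` in increasing order, the index `i` being repeated `x i`
times; this is the set of the `j`-th and the `(j + t)`-th entries (counting from `0`). -/
noncomputable def sortedPair {n : ℕ} (x : Fin n → ℕ) (t j : ℕ) : Finset (Fin n) :=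
  Finset.univ.filter fun i =>
    (prefixSum x i ≤ j ∧ j < prefixSum x (i + 1)) ∨
      (prefixSum x i ≤ j + t ∧ j + t < prefixSum x (i + 1))

lemma pathHeight_sortedPair {n t : ℕ} {x : Fin n → ℕ} (hx : ∀ i, x i ≤ t) (j : ℕ) {m : ℕ}
    (hm : m ≤ n) :
    pathHeight (sortedPair x t j) m =
      (if j < prefixSum x m then 1 else 0) + if j + t < prefixSum x m then 1 else 0 := by
  induction m with
  | zero => simp [pathHeight_zero, prefixSum_zero]
  | succ m ih =>
    have h₁ := hx ⟨m, hm⟩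
    rw [pathHeight_succ _ hm, ih (by omega)]
    simp only [sortedPair, Finset.mem_filter, Finset.mem_univ, true_and,
      prefixSum_succ x hm]
    split_ifs <;> omega

lemma sortedPair_mem_MklBases {n k l t : ℕ} (hk : 1 ≤ k) (hl : l < n) {x : Fin n → ℕ}
    (hx : x ∈ lpmRegion ℕ n k l t) {j : ℕ} (hj : j < t) :
    sortedPair x t j ∈ MklBases n k l := by
  obtain ⟨h₁, h₂, h₃, h₄⟩ := hx
  have hb : ∀ i, x i ≤ t := fun i => (h₁ i).2
  have hn : prefixSum x n = 2 * t := by rw [prefixSum_of_le _ le_rfl, h₂]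
  simp only [MklBases, Finset.mem_filter, Finset.mem_univ, true_and, Finset.mem_range]
  refine ⟨?_, fun m hm => ?_⟩
  · rw [← pathHeight_of_le _ le_rfl, pathHeight_sortedPair hb j le_rfl, hn, if_pos (by omega),
      if_pos (by omega)]
  · rw [pathHeight_sortedPair hb j (by omega)]
    have e₁ : n - k ≤ m → t ≤ prefixSum x m := fun h => h₃.trans (prefixSum_mono x h)
    have e₂ : n ≤ m → prefixSum x m = 2 * t := fun h => by rw [prefixSum_of_le _ h, h₂]
    have e₃ : m < n - l → prefixSum x m ≤ t := fun h =>
      (prefixSum_mono x (by omega : m ≤ n - l - 1)).trans h₄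
    have e₄ : m < 1 → prefixSum x m = 0 := fun h => by
      rw [Nat.lt_one_iff.mp h, prefixSum_zero]
    unfold lowerHt upperHt
    constructor <;> split_ifs <;> omega

lemma sum_indVec_sortedPair {n t : ℕ} {x : Fin n → ℕ} (hx : ∀ i, x i ≤ t)
    (hs : ∑ i, x i = 2 * t) :
    ∑ j ∈ Finset.range t, indVec (sortedPair x t j) = fun i => (x i : ℝ) := by
  ext i
  have h₁ := prefixSum_succ x i.isLt
  have h₂ : prefixSum x (i + 1) ≤ 2 * t := by
    rw [← hs, ← prefixSum_of_le x le_rfl]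
    exact prefixSum_mono x i.isLt
  have h₃ := hx i
  simp only [Fin.eta] at h₁
  simp only [Finset.sum_apply, indVec, sortedPair, Finset.mem_filter, Finset.mem_univ, true_and,
    Finset.sum_boole]
  norm_cast
  set a := prefixSum x i
  set b := prefixSum x (i + 1)
  have hu : (Finset.range t).filter (fun j => (a ≤ j ∧ j < b) ∨ (a ≤ j + t ∧ j + t < b)) =
      Finset.Ico a (min b t) ∪ Finset.Ico (a - t) (b - t) := by
    ext j
    simp only [Finset.mem_filter, Finset.mem_range, Finset.mem_union, Finset.mem_Ico]
    omega
  have hd : Disjoint (Finset.Ico a (min b t)) (Finset.Ico (a - t) (b - t)) := by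
    rw [Finset.disjoint_left]
    intro j
    simp only [Finset.mem_Ico]
    omega
  rw [hu, Finset.card_union_of_disjoint hd, Nat.card_Ico, Nat.card_Ico]
  omega

lemma MklPolytope_nonempty {n k l : ℕ} (hk : 1 ≤ k) (hk' : k < n) (hl : 1 ≤ l) (hl' : l < n) :
    (MklPolytope n k l).Nonempty := by
  refine Set.Nonempty.convexHull ⟨_, {⟨0, by omega⟩, ⟨n - 1, by omega⟩}, ?_, rfl⟩
  have hp (m : ℕ) (hm : m ≤ n) :
      pathHeight ({⟨0, by omega⟩, ⟨n - 1, by omega⟩} : Finset (Fin n)) m =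
        (if 1 ≤ m then 1 else 0) + if n ≤ m then 1 else 0 := by
    induction m with
    | zero => simp [pathHeight_zero]; omega
    | succ m ih =>
      rw [pathHeight_succ _ hm, ih (by omega)]
      simp only [Finset.mem_insert, Finset.mem_singleton, Fin.mk.injEq]
      split_ifs <;> omega
  simp only [MklBases, Finset.mem_filter, Finset.mem_univ, true_and, Finset.mem_range]
  refine ⟨?_, fun m hm => ?_⟩
  · rw [← pathHeight_of_le _ le_rfl, hp n le_rfl, if_pos (by omega), if_pos le_rfl]
  · rw [hp m (by omega)]
    unfold lowerHt upperHt
    constructor <;> split_ifs <;> omega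

lemma natCast_mem_smul_MklPolytope {n k l t : ℕ} (hk : 1 ≤ k) (hk' : k < n) (hl : 1 ≤ l)
    (hl' : l < n) {x : Fin n → ℕ} (hx : x ∈ lpmRegion ℕ n k l t) :
    (fun i => (x i : ℝ)) ∈ (t : ℝ) • MklPolytope n k l := by
  rw [← sum_indVec_sortedPair (fun i => (hx.1 i).2) hx.2.1]
  rcases Nat.eq_zero_or_pos t with rfl | ht
  · rw [Nat.cast_zero, Set.zero_smul_set (MklPolytope_nonempty hk hk' hl hl')]
    simp
  · have ht' : (t : ℝ) ≠ 0 := by positivity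
    rw [Set.mem_smul_set_iff_inv_smul_mem₀ ht', Finset.smul_sum]
    refine (convex_convexHull ℝ _).sum_mem (fun _ _ => by positivity) ?_ fun j hj =>
      subset_convexHull ℝ _ ⟨_, sortedPair_mem_MklBases hk hl' hx (Finset.mem_range.mp hj), rfl⟩
    simp [ht']

lemma latticeCount_smul_MklPolytope {n k l : ℕ} (t : ℕ) (hk : 1 ≤ k) (hk' : k < n)
    (hl : 1 ≤ l) (hl' : l < n) :
    latticeCount ((t : ℝ) • MklPolytope n k l) = (lpmRegion ℕ n k l t).ncard := by
  have hinj : Function.Injective fun (x : Fin n → ℕ) i => (x i : ℝ) := fun x y h =>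
    funext fun i => Nat.cast_injective (congrFun h i)
  rw [← Set.ncard_image_of_injective _ hinj, latticeCount]
  congr 1
  ext y
  constructor
  · rintro ⟨⟨p, hp, rfl⟩, hint⟩
    have hy := smul_mem_lpmRegion (Nat.cast_nonneg t) (MklPolytope_subset_lpmRegion hl' hp)
    have hnat : ∀ i, ∃ m : ℕ, ((t : ℝ) • p) i = m := fun i => by
      obtain ⟨z, hz⟩ := hint i
      have h₀ := (hy.1 i).1
      have hz' : ((t : ℝ) • p) i = z := hz
      rw [hz'] at h₀
      lift z to ℕ using by exact_mod_cast h₀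
      exact ⟨z, by simpa using hz'⟩
    choose x hx using hnat
    have hxp : (t : ℝ) • p = fun i => (x i : ℝ) := funext hx
    rw [hxp] at hy
    exact ⟨x, natCast_mem_lpmRegion.mp hy, hxp.symm⟩
  · rintro ⟨x, hx, rfl⟩
    exact ⟨natCast_mem_smul_MklPolytope hk hk' hl hl' hx, fun i => ⟨x i, by simp⟩⟩

lemma finite_lpmRegion (n k l t : ℕ) : (lpmRegion ℕ n k l t).Finite :=
  (Set.finite_Icc (fun _ => 0) fun _ => t).subset fun _ hx =>
    ⟨fun i => (hx.1 i).1, fun i => (hx.1 i).2⟩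

lemma ncard_lpmRegion_add {n k l : ℕ} (t : ℕ) (hk : 1 ≤ k) (hkl : k ≤ l) (hl : l ≤ n - 2)
    (hn : 4 ≤ n) :
    (lpmRegion ℕ n k l t).ncard + (lpmRegion ℕ n 1 (n - 2) t).ncard =
      (lpmRegion ℕ n 1 l t).ncard + (lpmRegion ℕ n 1 (n - k - 1) t).ncard := by
  have hlast {x : Fin n → ℕ} (hb : ∀ i, 0 ≤ x i ∧ x i ≤ t) (hs : ∑ i, x i = 2 * t) :
      t ≤ prefixSum x (n - 1) := by
    have h := prefixSum_succ x (show n - 1 < n by omega)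
    rw [prefixSum_of_le x (by omega), hs] at h
    have := (hb ⟨n - 1, by omega⟩).2
    omega
  have hfirst {x : Fin n → ℕ} (hb : ∀ i, 0 ≤ x i ∧ x i ≤ t) : prefixSum x 1 ≤ t := by
    rw [prefixSum_succ x (show 0 < n by omega), prefixSum_zero, zero_add]
    exact (hb _).2
  have hrev : (lpmRegion ℕ n 1 (n - k - 1) t).ncard = (lpmRegion ℕ n k (n - 2) t).ncard := by
    refine Set.ncard_congr (fun x _ => x ∘ Fin.rev) ?_ ?_ ?_
    · rintro x ⟨h₁, h₂, -, h₄⟩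
      have hr := prefixSum_comp_rev x (n - k)
      rw [show n - (n - k) = k by omega, h₂] at hr
      rw [show n - (n - k - 1) - 1 = k by omega] at h₄
      refine ⟨fun i => h₁ _, (Equiv.sum_comp Fin.revPerm x).trans h₂, by omega, ?_⟩
      rw [show n - (n - 2) - 1 = 1 by omega]
      exact hfirst fun i => h₁ _
    · intro x y _ _ h
      funext i
      simpa using congrFun h i.rev
    · rintro y ⟨h₁, h₂, h₃, -⟩
      have h₂' : ∑ i, (y ∘ Fin.rev) i = 2 * t := (Equiv.sum_comp Fin.revPerm y).trans h₂
      refine ⟨y ∘ Fin.rev, ⟨fun i => h₁ _, h₂', hlast (fun i => h₁ _) h₂', ?_⟩, ?_⟩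
      · have hr := prefixSum_comp_rev y k
        rw [show n - (n - k - 1) - 1 = k by omega]
        omega
      · funext i
        simp
  have hinter : lpmRegion ℕ n k l t = lpmRegion ℕ n 1 l t ∩ lpmRegion ℕ n k (n - 2) t := by
    ext x
    constructor
    · rintro ⟨h₁, h₂, h₃, h₄⟩
      refine ⟨⟨h₁, h₂, hlast h₁ h₂, h₄⟩, h₁, h₂, h₃, ?_⟩
      rw [show n - (n - 2) - 1 = 1 by omega]
      exact hfirst h₁
    · rintro ⟨⟨h₁, h₂, -, h₄⟩, -, -, h₃, -⟩
      exact ⟨h₁, h₂, h₃, h₄⟩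
  have hunion : lpmRegion ℕ n 1 (n - 2) t = lpmRegion ℕ n 1 l t ∪ lpmRegion ℕ n k (n - 2) t := by
    ext x
    constructor
    · rintro ⟨h₁, h₂, h₃, h₄⟩
      have hm := prefixSum_mono x (show n - l - 1 ≤ n - k by omega)
      rcases le_total (prefixSum x (n - l - 1)) t with h | h
      · exact Or.inl ⟨h₁, h₂, h₃, h⟩
      · exact Or.inr ⟨h₁, h₂, h.trans hm, h₄⟩
    · rintro (⟨h₁, h₂, h₃, -⟩ | ⟨h₁, h₂, -, h₄⟩)
      · refine ⟨h₁, h₂, h₃, ?_⟩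
        rw [show n - (n - 2) - 1 = 1 by omega]
        exact hfirst h₁
      · exact ⟨h₁, h₂, hlast h₁ h₂, h₄⟩
  rw [hrev, hinter, hunion, add_comm]
  exact Set.ncard_union_add_ncard_inter _ _ (finite_lpmRegion ..) (finite_lpmRegion ..)

/-- The polynomials `C(t + d - k, d)`, `0 ≤ k ≤ d`, are linearly independent. -/
lemma eq_of_sum_mul_choose_eq {d : ℕ} {f g : ℕ → ℕ}
    (h : ∀ t, ∑ k ∈ Finset.range (d + 1), f k * Nat.choose (t + d - k) d =
      ∑ k ∈ Finset.range (d + 1), g k * Nat.choose (t + d - k) d) {m : ℕ} (hm : m ≤ d) :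
    f m = g m := by
  induction m using Nat.strong_induction_on with
  | _ m ih =>
    have key (e : ℕ → ℕ) : ∑ k ∈ Finset.range (d + 1), e k * Nat.choose (m + d - k) d =
        ∑ k ∈ Finset.range m, e k * Nat.choose (m + d - k) d + e m := by
      rw [← Finset.sum_subset (Finset.range_subset_range.mpr (show m + 1 ≤ d + 1 by omega)),
        Finset.sum_range_succ, Nat.add_sub_cancel_left, Nat.choose_self, mul_one]
      intro k hk hk'
      simp only [Finset.mem_range] at hk hk'
      rw [Nat.choose_eq_zero_of_lt (by omega), mul_zero]
    have hs := h m
    rw [key, key, Finset.sum_congr rfl fun k hk => by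
      rw [ih k (Finset.mem_range.mp hk) ((Finset.mem_range.mp hk).le.trans hm)]] at hs
    exact Nat.add_left_cancel hs

/-- Let `M = M_n[k,ℓ]` be a rank-2 lattice path matroid on `[n]`
with `n ≥ 4` and `1 ≤ k ≤ ℓ ≤ n-2`.  For every `m ≥ 0`,
`h*_m(P_{M_n[k,ℓ]}) = h*_m(P_{M_n[1,ℓ]}) + h*_m(P_{M_n[1,n-k-1]}) - h*_m(P_{U_{2,n}})`,
where `U_{2,n} = M_n[1,n-2]` is the uniform matroid of rank 2. -/
theorem hstar_rank_two_lpm_from_schubert (n k l : ℕ) (hn : 4 ≤ n) (hk : 1 ≤ k)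
    (hkl : k ≤ l) (hl : l ≤ n - 2)
    (h₁ h₂ h₃ h₄ : ℕ → ℕ)
    (hh₁ : IsHStarVector (MklPolytope n k l) (n - 1) h₁)
    (hh₂ : IsHStarVector (MklPolytope n 1 l) (n - 1) h₂)
    (hh₃ : IsHStarVector (MklPolytope n 1 (n - k - 1)) (n - 1) h₃)
    (hh₄ : IsHStarVector (MklPolytope n 1 (n - 2)) (n - 1) h₄) :
    ∀ m : ℕ, (h₁ m : ℤ) = (h₂ m : ℤ) + (h₃ m : ℤ) - (h₄ m : ℤ) := by
  have hsum (t : ℕ) : ∑ i ∈ Finset.range (n - 1 + 1),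
        (h₁ i + h₄ i) * Nat.choose (t + (n - 1) - i) (n - 1) =
      ∑ i ∈ Finset.range (n - 1 + 1),
        (h₂ i + h₃ i) * Nat.choose (t + (n - 1) - i) (n - 1) := by
    simp only [add_mul, Finset.sum_add_distrib]
    rw [← hh₁.1 t, ← hh₂.1 t, ← hh₃.1 t, ← hh₄.1 t,
      latticeCount_smul_MklPolytope t hk (by omega) (by omega) (by omega),
      latticeCount_smul_MklPolytope t le_rfl (by omega) (by omega) (by omega),
      latticeCount_smul_MklPolytope t le_rfl (by omega) (by omega) (by omega),
      latticeCount_smul_MklPolytope t le_rfl (by omega) (by omega) (by omega)]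
    exact ncard_lpmRegion_add t hk hkl hl hn
  intro m
  rcases le_or_gt m (n - 1) with hm | hm
  · have := eq_of_sum_mul_choose_eq (f := fun i => h₁ i + h₄ i) (g := fun i => h₂ i + h₃ i)
      hsum hm
    omega
  · rw [hh₁.2 m hm, hh₂.2 m hm, hh₃.2 m hm, hh₄.2 m hm]
    simp
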